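/- arXiv:1701.05521 — 8 statements merged into one kernel-verified Lean document; each statement's English description precedes it below -/
import Mathlib

section
/- Let ι be a real number with 0 < ι < 1. For each natural number n set r(n, ι) = (1/(1−ι))^n and define f_{n,ι} : ℝ → ℝ by f_{n,ι}(x) = (1 − (1−x)^n)^{⌈r(n,ι)⌉}, where the exponent is the natural-number ceiling of r(n,ι). Then for every x ∈ [0,1]: if x < ι then f_{n,ι}(x) tends to 0 as n → ∞, and if x > ι then f_{n,ι}(x) tends to 1 as n → ∞. -/
open Filter Topology

/-- If `1 < p * q`, then `(1 - p ^ n) ^ ⌈q ^ n⌉₊` tends to `0`. -/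
theorem tendsto_one_sub_pow_pow_ceil_zero {p q : ℝ} (hp0 : 0 ≤ p) (hp1 : p ≤ 1)
    (hpq : 1 < p * q) :
    Tendsto (fun n : ℕ => (1 - p ^ n) ^ ⌈q ^ n⌉₊) atTop (𝓝 0) := by
  have hexp : Tendsto (fun n : ℕ => Real.exp (-(p * q) ^ n)) atTop (𝓝 0) :=
    Real.tendsto_exp_neg_atTop_nhds_zero.comp (tendsto_pow_atTop_atTop_of_one_lt hpq)
  have hnonneg (n : ℕ) : 0 ≤ 1 - p ^ n := sub_nonneg.2 (pow_le_one₀ hp0 hp1)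
  refine squeeze_zero (fun n => pow_nonneg (hnonneg n) _) (fun n => ?_) hexp
  calc (1 - p ^ n) ^ ⌈q ^ n⌉₊
      ≤ Real.exp (-p ^ n) ^ ⌈q ^ n⌉₊ :=
        pow_le_pow_left₀ (hnonneg n) (Real.one_sub_le_exp_neg _) _
    _ = Real.exp (-(p ^ n * ⌈q ^ n⌉₊)) := by rw [← Real.exp_nat_mul]; ring_nf
    _ ≤ Real.exp (-(p * q) ^ n) := by
        rw [mul_pow]
        gcongr
        exact Nat.le_ceil _

/-- If `p < 1` and `p * q < 1`, then `(1 - p ^ n) ^ ⌈q ^ n⌉₊` tends to `1`. -/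
theorem tendsto_one_sub_pow_pow_ceil_one {p q : ℝ} (hp0 : 0 ≤ p) (hp1 : p < 1)
    (hq0 : 0 ≤ q) (hpq : p * q < 1) :
    Tendsto (fun n : ℕ => (1 - p ^ n) ^ ⌈q ^ n⌉₊) atTop (𝓝 1) := by
  have hlower : Tendsto (fun n : ℕ => 1 - ((p * q) ^ n + p ^ n)) atTop (𝓝 1) := by
    simpa using ((tendsto_pow_atTop_nhds_zero_of_lt_one (mul_nonneg hp0 hq0) hpq).add
      (tendsto_pow_atTop_nhds_zero_of_lt_one hp0 hp1)).const_sub 1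
  refine tendsto_of_tendsto_of_tendsto_of_le_of_le hlower tendsto_const_nhds
    (fun n => ?_) (fun n => ?_)
  · have hpn : p ^ n ≤ 1 := pow_le_one₀ hp0 hp1.le
    have hceil : (⌈q ^ n⌉₊ : ℝ) * p ^ n ≤ (q ^ n + 1) * p ^ n := by
      gcongr
      exact (Nat.ceil_lt_add_one (pow_nonneg hq0 n)).le
    have hbernoulli := one_add_mul_le_pow (by linarith : -2 ≤ -p ^ n) ⌈q ^ n⌉₊
    rw [← sub_eq_add_neg] at hbernoulli
    dsimp only
    rw [mul_pow]
    linarith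
  · exact pow_le_one₀ (sub_nonneg.2 (pow_le_one₀ hp0 hp1.le))
      (sub_le_self _ (pow_nonneg hp0 n))

theorem limit_amplification (ι : ℝ) (hι0 : 0 < ι) (hι1 : ι < 1) :
    ∀ x ∈ Set.Icc (0 : ℝ) 1,
      (x < ι →
        Filter.Tendsto (fun n : ℕ => (1 - (1 - x) ^ n) ^ ⌈(1 / (1 - ι)) ^ n⌉₊)
          Filter.atTop (nhds 0)) ∧
      (x > ι →
        Filter.Tendsto (fun n : ℕ => (1 - (1 - x) ^ n) ^ ⌈(1 / (1 - ι)) ^ n⌉₊)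
          Filter.atTop (nhds 1)) := by
  rintro x ⟨hx0, hx1⟩
  have hι : 0 < 1 - ι := sub_pos.2 hι1
  refine ⟨fun hx => tendsto_one_sub_pow_pow_ceil_zero (by linarith) (by linarith) ?_,
    fun hx => tendsto_one_sub_pow_pow_ceil_one (by linarith) (by linarith)
      (by positivity) ?_⟩
  · rw [mul_one_div, one_lt_div hι]
    linarith
  · rw [mul_one_div, div_lt_one hι]
    linarith
end

section
/- For all real numbers a, b with 0 ≤ a < b ≤ 1 and every real γ > 0, there exist natural numbers n and m such that (1 − (1−b)^m)^n − (1 − (1−a)^m)^n ≥ 1 − γ. -/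
theorem one_sub_pow_mul_one_add_mul_le_one {x : ℝ} (hx₀ : 0 ≤ x) (hx₁ : x ≤ 1) (n : ℕ) :
    (1 - x) ^ n * (1 + n * x) ≤ 1 :=
  calc (1 - x) ^ n * (1 + n * x) ≤ (1 - x) ^ n * (1 + x) ^ n :=
        mul_le_mul_of_nonneg_left (one_add_mul_le_pow (by linarith) n)
          (pow_nonneg (by linarith) n)
    _ = (1 - x ^ 2) ^ n := by rw [← mul_pow]; ring
    _ ≤ 1 := pow_le_one₀ (by nlinarith) (by nlinarith)

theorem amplification_core (a b γ : ℝ) (ha : 0 ≤ a) (hab : a < b) (hb : b ≤ 1)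
    (hγ : 0 < γ) :
    ∃ n m : ℕ, (1 - (1 - b) ^ m) ^ n - (1 - (1 - a) ^ m) ^ n ≥ 1 - γ := by
  obtain ⟨q, hq⟩ : ∃ q, q = 1 - a := ⟨_, rfl⟩
  obtain ⟨r, hr⟩ : ∃ r, r = 1 - b := ⟨_, rfl⟩
  rw [← hq, ← hr]
  have hq₀ : 0 < q := by linarith
  have hq₁ : q ≤ 1 := by linarith
  have hr₀ : 0 ≤ r := by linarith
  have hrq : r / q < 1 := (div_lt_one hq₀).2 (by linarith)
  have hK : 0 < 2 / γ := by positivity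
  obtain ⟨m, hm⟩ := exists_pow_lt_of_lt_one
    (show 0 < γ / 2 / (2 / γ + 1) by positivity) hrq
  rw [lt_div_iff₀ (by positivity)] at hm
  have hqm : 0 < q ^ m := pow_pos hq₀ m
  have hqm₁ : q ^ m ≤ 1 := pow_le_one₀ hq₀.le hq₁
  have hrm : 0 ≤ r ^ m := pow_nonneg hr₀ m
  have hrm₁ : r ^ m ≤ 1 := pow_le_one₀ hr₀ (by linarith)
  refine ⟨⌈2 / γ / q ^ m⌉₊, m, ?_⟩
  have hn_ge := Nat.le_ceil (2 / γ / q ^ m)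
  have hn_lt := Nat.ceil_lt_add_one (show 0 ≤ 2 / γ / q ^ m by positivity)
  generalize ⌈2 / γ / q ^ m⌉₊ = n at hn_ge hn_lt ⊢
  have h_lower : 1 - n * r ^ m ≤ (1 - r ^ m) ^ n := by
    have h := one_add_mul_le_pow (show -2 ≤ -r ^ m by linarith) n
    rw [← sub_eq_add_neg] at h
    linarith
  have h_small : n * r ^ m ≤ γ / 2 :=
    calc n * r ^ m ≤ (2 / γ / q ^ m + 1) * r ^ m := by gcongr
      _ = 2 / γ * (r / q) ^ m + r ^ m := by rw [div_pow]; ring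
      _ ≤ 2 / γ * (r / q) ^ m + (r / q) ^ m := by
        gcongr
        exact le_div_self hr₀ hq₀ hq₁
      _ ≤ γ / 2 := by linarith
  have h_upper : (1 - q ^ m) ^ n ≤ γ / 2 := by
    have h := one_sub_pow_mul_one_add_mul_le_one hqm.le hqm₁ n
    have hn : 2 / γ ≤ n * q ^ m := (div_le_iff₀ hqm).1 hn_ge
    have hp : 0 ≤ (1 - q ^ m) ^ n := pow_nonneg (by linarith) n
    have h' : (1 - q ^ m) ^ n * (2 / γ) ≤ 1 :=
      (mul_le_mul_of_nonneg_left (by linarith) hp).trans h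
    rw [← le_div_iff₀ hK, one_div_div] at h'
    exact h'
  linarith
end

section
/- For all real numbers α, β ∈ [0,1] with α ≠ β and every real γ with 0 < γ, there exist a natural number n and rational numbers c_0, …, c_n, each lying in [0,1], such that the polynomial function P(x) = Σ_{k=0}^{n} c_k · (n choose k) · x^k · (1−x)^{n−k} satisfies: P(x) ∈ [0,1] for every x ∈ [0,1], and |P(α) − P(β)| ≥ 1 − γ. -/
open Filter Topology in
/-- For rational `r < s`, the Bernstein approximations of the piecewise linear ramp which is `0` up
to `r` and `1` from `s` on have rational coefficients, and tend to the ramp on `[0, 1]`. -/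
theorem tendsto_bernstein_ramp (r s : ℚ) {x : ℝ} (hx : x ∈ Set.Icc (0 : ℝ) 1) :
    Tendsto (fun n : ℕ => ∑ k ∈ Finset.range (n + 1),
      ((max 0 (min 1 (((k : ℚ) / n - r) / (s - r))) : ℚ) : ℝ) * (n.choose k : ℝ) * x ^ k *
        (1 - x) ^ (n - k))
      atTop (𝓝 (max 0 (min 1 ((x - r) / (s - r))))) := by
  let f : C(unitInterval, ℝ) :=
    ⟨fun y => max 0 (min 1 (((y : ℝ) - r) / (s - r))), by fun_prop⟩
  have h := ((continuous_eval_const (F := C(unitInterval, ℝ))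
    (⟨x, hx⟩ : unitInterval)).tendsto f).comp (bernsteinApproximation_uniform f)
  refine h.congr fun n => ?_
  simp only [Function.comp_apply, bernsteinApproximation.apply, bernstein_apply, Finset.sum_range,
    smul_eq_mul]
  refine Finset.sum_congr rfl fun k _ => ?_
  simp only [f, ContinuousMap.coe_mk, bernstein.z]
  push_cast
  ring

/-- A polynomial in Bernstein form with coefficients in `[0, 1]` maps `[0, 1]` to itself. -/
theorem sum_bernstein_mem_Icc {n : ℕ} {c : ℕ → ℝ} (hc : ∀ k ≤ n, c k ∈ Set.Icc (0 : ℝ) 1)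
    {x : ℝ} (hx : x ∈ Set.Icc (0 : ℝ) 1) :
    (∑ k ∈ Finset.range (n + 1), c k * (n.choose k : ℝ) * x ^ k * (1 - x) ^ (n - k)) ∈
      Set.Icc (0 : ℝ) 1 := by
  have hp : ∑ k ∈ Finset.range (n + 1), (n.choose k : ℝ) * x ^ k * (1 - x) ^ (n - k) = 1 := by
    simpa [Finset.sum_range, bernstein_apply] using bernstein.probability n ⟨x, hx⟩
  have hb (k : ℕ) : 0 ≤ (n.choose k : ℝ) * x ^ k * (1 - x) ^ (n - k) :=
    bernstein_apply n k ⟨x, hx⟩ ▸ bernstein_nonneg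
  have hk {k : ℕ} (hk : k ∈ Finset.range (n + 1)) : k ≤ n :=
    Nat.lt_succ_iff.mp (Finset.mem_range.mp hk)
  simp only [mul_assoc] at hp hb ⊢
  exact ⟨Finset.sum_nonneg fun k h => mul_nonneg (hc k (hk h)).1 (hb k),
    (Finset.sum_le_sum fun k h => mul_le_of_le_one_left (hb k) (hc k (hk h)).2).trans_eq hp⟩

theorem bernstein_amplification (α β γ : ℝ)
    (hα : α ∈ Set.Icc (0 : ℝ) 1) (hβ : β ∈ Set.Icc (0 : ℝ) 1)
    (hαβ : α ≠ β) (hγ : 0 < γ) :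
    ∃ (n : ℕ) (c : ℕ → ℚ),
      (∀ k ≤ n, 0 ≤ c k ∧ c k ≤ 1) ∧
      (∀ x ∈ Set.Icc (0 : ℝ) 1,
        (∑ k ∈ Finset.range (n + 1),
          (c k : ℝ) * (n.choose k : ℝ) * x ^ k * (1 - x) ^ (n - k)) ∈
            Set.Icc (0 : ℝ) 1) ∧
      |(∑ k ∈ Finset.range (n + 1),
          (c k : ℝ) * (n.choose k : ℝ) * α ^ k * (1 - α) ^ (n - k)) -
        (∑ k ∈ Finset.range (n + 1),
          (c k : ℝ) * (n.choose k : ℝ) * β ^ k * (1 - β) ^ (n - k))| ≥ 1 - γ := by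
  wlog h : α < β generalizing α β
  · obtain ⟨n, c, hc, hP, hd⟩ := this β α hβ hα hαβ.symm (hαβ.lt_or_gt.resolve_left h)
    exact ⟨n, c, hc, hP, by rwa [abs_sub_comm]⟩
  obtain ⟨r, hαr, hrβ⟩ := exists_rat_btwn h
  obtain ⟨s, hrs, hsβ⟩ := exists_rat_btwn hrβ
  have hpos : (0 : ℝ) < s - r := sub_pos.mpr hrs
  have hfα : max 0 (min 1 ((α - r) / (s - r))) = (0 : ℝ) :=
    max_eq_left ((min_le_right _ _).trans
      (div_nonpos_of_nonpos_of_nonneg (sub_nonpos.mpr hαr.le) hpos.le))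
  have hfβ : max 0 (min 1 ((β - r) / (s - r))) = (1 : ℝ) := by
    rw [min_eq_left ((one_le_div hpos).mpr (by linarith)), max_eq_right zero_le_one]
  have hlim := ((tendsto_bernstein_ramp r s hα).sub (tendsto_bernstein_ramp r s hβ)).abs
  rw [hfα, hfβ, zero_sub, abs_neg, abs_one] at hlim
  obtain ⟨n, hn⟩ := (hlim.eventually_const_le (sub_lt_self 1 hγ)).exists
  have hc (k : ℕ) : 0 ≤ max 0 (min 1 (((k : ℚ) / n - r) / (s - r))) ∧
      max 0 (min 1 (((k : ℚ) / n - r) / (s - r))) ≤ 1 :=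
    ⟨le_max_left _ _, max_le zero_le_one (min_le_left _ _)⟩
  exact ⟨n, _, fun k _ => hc k, fun x hx => sum_bernstein_mem_Icc
    (fun k _ => ⟨by exact_mod_cast (hc k).1, by exact_mod_cast (hc k).2⟩) hx, hn⟩
end

section
/- For all real numbers α, β ∈ [0,1] with α ≠ β, there exists a continuous function f : [0,1] → ℝ such that f(x) ∈ [0,1] for all x ∈ [0,1], f(α) = 0, f(β) = 1, and f(q) is a rational number for every rational q ∈ [0,1]. -/
/-- Two points `a < b` on the real line are separated by a continuous `[0, 1]`-valued function
which maps rational numbers to rational numbers. -/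
theorem exists_continuous_rat_separating_of_lt {a b : ℝ} (hab : a < b) :
    ∃ f : ℝ → ℝ, Continuous f ∧ (∀ x, f x ∈ Set.Icc (0 : ℝ) 1) ∧ f a = 0 ∧ f b = 1 ∧
      ∀ q : ℚ, ∃ r : ℚ, f q = r := by
  obtain ⟨u, hau, hub⟩ := exists_rat_btwn hab
  obtain ⟨v, huv, hvb⟩ := exists_rat_btwn hub
  have hpos : (0 : ℝ) < v - u := sub_pos.2 huv
  refine ⟨fun x => max 0 (min 1 ((x - u) / (v - u))), by fun_prop,
    fun x => ⟨le_max_left _ _, max_le zero_le_one (min_le_left _ _)⟩, ?_, ?_,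
    fun q => ⟨max 0 (min 1 ((q - u) / (v - u))), by push_cast; rfl⟩⟩
  · exact max_eq_left ((min_le_right _ _).trans
      (div_nonpos_of_nonpos_of_nonneg (by linarith) hpos.le))
  · have h : 1 ≤ (b - u) / (v - u) := (one_le_div hpos).2 (by linarith)
    simp [min_eq_left h]

theorem exists_continuous_separating (α β : ℝ)
    (hα : α ∈ Set.Icc (0 : ℝ) 1) (hβ : β ∈ Set.Icc (0 : ℝ) 1) (hαβ : α ≠ β) :
    ∃ f : ℝ → ℝ,
      ContinuousOn f (Set.Icc (0 : ℝ) 1) ∧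
      (∀ x ∈ Set.Icc (0 : ℝ) 1, f x ∈ Set.Icc (0 : ℝ) 1) ∧
      f α = 0 ∧ f β = 1 ∧
      (∀ q : ℚ, (q : ℝ) ∈ Set.Icc (0 : ℝ) 1 → ∃ r : ℚ, f (q : ℝ) = (r : ℝ)) := by
  rcases hαβ.lt_or_gt with h | h
  · obtain ⟨f, hf, hmem, h0, h1, hq⟩ := exists_continuous_rat_separating_of_lt h
    exact ⟨f, hf.continuousOn, fun x _ => hmem x, h0, h1, fun q _ => hq q⟩
  · obtain ⟨f, hf, hmem, h0, h1, hq⟩ := exists_continuous_rat_separating_of_lt h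
    refine ⟨fun x => 1 - f x, by fun_prop,
      fun x _ => ⟨sub_nonneg.2 (hmem x).2, sub_le_self _ (hmem x).1⟩, by simp [h1], by simp [h0],
      fun q _ => ?_⟩
    obtain ⟨r, hr⟩ := hq q
    exact ⟨1 - r, by simp [hr]⟩
end

section
/- Consider a weighted labelled transition system (WLTS) given by a type S of states, a type A of actions, a deterministic partial transition function step : S → A → Option S, and a weight function w : S → ℝ with 0 ≤ w s ≤ 1 for all s. Let ε ∈ ℝ with 0 ≤ ε ≤ 1, let R be an ε-bisimulation, and let t, s ∈ S with R t s. Then for every trace T (a finite list of actions): if T is admissible for t, then T is admissible for s, the unique states u and v reached from t and s along T satisfy R u v, and consequently |Pr(T, t) − Pr(T, s)| ≤ ε. -/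
/-- `R` is an ε-bisimulation on the WLTS given by `step` and `w`. -/
def IsEpsBisim {S A : Type*} (step : S → A → Option S) (w : S → ℝ) (ε : ℝ)
    (R : S → S → Prop) : Prop :=
  (∀ s, R s s) ∧ (∀ t s, R t s → R s t) ∧
  ∀ t s, R t s →
    (∀ a u, step t a = some u → ∃ v, step s a = some v ∧ R u v) ∧
    |w t - w s| ≤ ε

/-- Running a trace (a list of actions) from a state. -/
def runTrace {S A : Type*} (step : S → A → Option S) : S → List A → Option S
  | t, [] => some t
  | t, a :: T => (step t a).bind fun u => runTrace step u T

/-- The success probability of a trace from a state (0 if not admissible). -/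
def prTrace {S A : Type*} (step : S → A → Option S) (w : S → ℝ)
    (t : S) (T : List A) : ℝ :=
  (runTrace step t T).elim 0 w

/-- Related states stay related along every admissible trace. -/
theorem IsEpsBisim.exists_runTrace {S A : Type*} {step : S → A → Option S} {w : S → ℝ} {ε : ℝ}
    {R : S → S → Prop} (hR : IsEpsBisim step w ε R) {t s u : S} (hts : R t s) {T : List A}
    (hu : runTrace step t T = some u) : ∃ v, runTrace step s T = some v ∧ R u v := by
  induction T generalizing t s with
  | nil =>
    obtain rfl : t = u := Option.some.inj hu
    exact ⟨s, rfl, hts⟩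
  | cons a T ih =>
    obtain ⟨t', ht', hu⟩ := Option.bind_eq_some_iff.mp hu
    obtain ⟨s', hs', hR'⟩ := (hR.2.2 t s hts).1 a t' ht'
    obtain ⟨v, hv, huv⟩ := ih hR' hu
    exact ⟨v, Option.bind_eq_some_iff.mpr ⟨s', hs', hv⟩, huv⟩

theorem bisim_trace_bound {S A : Type*} (step : S → A → Option S) (w : S → ℝ)
    (hw : ∀ s, 0 ≤ w s ∧ w s ≤ 1) (ε : ℝ) (hε0 : 0 ≤ ε) (hε1 : ε ≤ 1)
    (R : S → S → Prop) (hR : IsEpsBisim step w ε R) (t s : S) (hts : R t s) :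
    ∀ T : List A, (runTrace step t T).isSome →
      (runTrace step s T).isSome ∧
      (∃ u v, runTrace step t T = some u ∧ runTrace step s T = some v ∧ R u v) ∧
      |prTrace step w t T - prTrace step w s T| ≤ ε := by
  intro T hT
  obtain ⟨u, hu⟩ := Option.isSome_iff_exists.mp hT
  obtain ⟨v, hv, huv⟩ := hR.exists_runTrace hts hu
  refine ⟨Option.isSome_iff_exists.mpr ⟨v, hv⟩, ⟨u, v, hu, hv, huv⟩, ?_⟩
  simpa only [prTrace, hu, hv, Option.elim_some] using (hR.2.2 u v huv).2
end

section
/- Consider a weighted labelled transition system (WLTS) given by a type S of states, a type A of actions, a deterministic partial transition function step : S → A → Option S, and a weight function w : S → ℝ with 0 ≤ w s ≤ 1 for all s. Let t, s ∈ S have the same set of admissible traces, and let ε ∈ ℝ with 0 ≤ ε ≤ 1. If no ε-bisimulation relates t and s, then there exists a trace T such that |Pr(T, t) − Pr(T, s)| ≥ ε. -/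
/-- Two states with the same admissible traces, whose success probabilities differ by at most `ε`
on every trace. -/
def TraceClose {S A : Type*} (step : S → A → Option S) (w : S → ℝ) (ε : ℝ) (t s : S) : Prop :=
  ∀ T : List A, ((runTrace step t T).isSome ↔ (runTrace step s T).isSome) ∧
    |prTrace step w t T - prTrace step w s T| ≤ ε

theorem runTrace_cons_of_step {S A : Type*} {step : S → A → Option S} {t u : S} {a : A}
    (h : step t a = some u) (T : List A) : runTrace step t (a :: T) = runTrace step u T := by
  simp [runTrace, h]

theorem prTrace_cons_of_step {S A : Type*} {step : S → A → Option S} (w : S → ℝ) {t u : S} {a : A}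
    (h : step t a = some u) (T : List A) : prTrace step w t (a :: T) = prTrace step w u T := by
  simp [prTrace, runTrace_cons_of_step h]

theorem isEpsBisim_traceClose {S A : Type*} (step : S → A → Option S) (w : S → ℝ) {ε : ℝ}
    (hε : 0 ≤ ε) : IsEpsBisim step w ε (TraceClose step w ε) := by
  refine ⟨fun s T => ⟨Iff.rfl, by simpa using hε⟩,
    fun t s h T => ⟨(h T).1.symm, by rw [abs_sub_comm]; exact (h T).2⟩,
    fun t s h => ⟨fun a u hu => ?_, by simpa [prTrace, runTrace] using (h []).2⟩⟩
  have hs : (step s a).isSome := by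
    simpa [runTrace, hu, Option.isSome_iff_exists] using (h [a]).1
  obtain ⟨v, hv⟩ := Option.isSome_iff_exists.mp hs
  refine ⟨v, hv, fun T => ?_⟩
  have hT := h (a :: T)
  rwa [runTrace_cons_of_step hu, runTrace_cons_of_step hv, prTrace_cons_of_step w hu,
    prTrace_cons_of_step w hv] at hT

theorem not_bisim_exists_trace {S A : Type*} (step : S → A → Option S) (w : S → ℝ)
    (hw : ∀ s, 0 ≤ w s ∧ w s ≤ 1) (t s : S) (ε : ℝ) (hε0 : 0 ≤ ε) (hε1 : ε ≤ 1)
    (hadm : ∀ T : List A, (runTrace step t T).isSome ↔ (runTrace step s T).isSome)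
    (hno : ¬ ∃ R, IsEpsBisim step w ε R ∧ R t s) :
    ∃ T : List A, |prTrace step w t T - prTrace step w s T| ≥ ε := by
  by_contra! hlt
  exact hno ⟨TraceClose step w ε, isEpsBisim_traceClose step w hε0,
    fun T => ⟨hadm T, (hlt T).le⟩⟩
end

section
/- Consider a weighted labelled transition system (WLTS) given by a type S of states, a type A of actions, a deterministic partial transition function step : S → A → Option S, and a weight function w : S → ℝ with 0 ≤ w s ≤ 1 for all s. Let ε, ε' ∈ ℝ with 0 ≤ ε and 0 ≤ ε'. If R is an ε-bisimulation relating t and s, and R' is an ε'-bisimulation relating s and u, then there exists an (ε + ε')-bisimulation relating t and u; namely, the symmetric closure of the relational composition of R and R' is an (ε + ε')-bisimulation. (Hence the bisimulation distance satisfies the triangle inequality, and is a pseudometric.) -/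
theorem bisim_triangle {S A : Type*} (step : S → A → Option S) (w : S → ℝ)
    (hw : ∀ s, 0 ≤ w s ∧ w s ≤ 1) (ε ε' : ℝ) (hε : 0 ≤ ε) (hε' : 0 ≤ ε')
    (R R' : S → S → Prop) (t s u : S)
    (hR : IsEpsBisim step w ε R) (hts : R t s)
    (hR' : IsEpsBisim step w ε' R') (hsu : R' s u) :
    IsEpsBisim step w (ε + ε')
      (fun x z => (∃ y, R x y ∧ R' y z) ∨ (∃ y, R z y ∧ R' y x)) ∧
    ((∃ y, R t y ∧ R' y u) ∨ (∃ y, R u y ∧ R' y t)) := by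
  obtain ⟨rR, sR, bR⟩ := hR
  obtain ⟨rR', sR', bR'⟩ := hR'
  refine ⟨⟨fun x => Or.inl ⟨x, rR x, rR' x⟩, fun _ _ h => h.symm, ?_⟩,
    Or.inl ⟨s, hts, hsu⟩⟩
  rintro x z (⟨y, hxy, hyz⟩ | ⟨y, hzy, hyx⟩)
  · obtain ⟨h₁, d₁⟩ := bR x y hxy
    obtain ⟨h₂, d₂⟩ := bR' y z hyz
    refine ⟨fun a p hp => ?_, ?_⟩
    · obtain ⟨q, hq, hpq⟩ := h₁ a p hp
      obtain ⟨r, hr, hqr⟩ := h₂ a q hq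
      exact ⟨r, hr, Or.inl ⟨q, hpq, hqr⟩⟩
    · exact (abs_sub_le _ (w y) _).trans (add_le_add d₁ d₂)
  · obtain ⟨h₁, d₁⟩ := bR y z (sR z y hzy)
    obtain ⟨h₂, d₂⟩ := bR' x y (sR' y x hyx)
    refine ⟨fun a p hp => ?_, ?_⟩
    · obtain ⟨q, hq, hpq⟩ := h₂ a p hp
      obtain ⟨r, hr, hqr⟩ := h₁ a q hq
      exact ⟨r, hr, Or.inr ⟨q, sR q r hqr, sR' p q hpq⟩⟩
    · rw [add_comm]
      exact (abs_sub_le _ (w y) _).trans (add_le_add d₂ d₁)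
end

section
/- Let ε, μ ∈ [0,1) be real numbers with ε ≠ μ. Then 0 < |ε − μ| ≤ sup_{n ≥ 1} |ε^n − μ^n| ≤ max(ε, μ) < 1, where the supremum is over natural numbers n ≥ 1. In particular, sup_{n ≥ 1} |ε^n − μ^n| lies strictly between 0 and 1. -/
theorem abs_pow_sub_pow_le_max {a b : ℝ} (ha : a ∈ Set.Ico (0 : ℝ) 1)
    (hb : b ∈ Set.Ico (0 : ℝ) 1) {n : ℕ} (hn : 1 ≤ n) :
    |a ^ n - b ^ n| ≤ max a b := by
  have hn0 : n ≠ 0 := Nat.one_le_iff_ne_zero.mp hn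
  have ha1 : a ^ n ≤ a := pow_le_of_le_one ha.1 ha.2.le hn0
  have hb1 : b ^ n ≤ b := pow_le_of_le_one hb.1 hb.2.le hn0
  have ha0 : 0 ≤ a ^ n := pow_nonneg ha.1 n
  have hb0 : 0 ≤ b ^ n := pow_nonneg hb.1 n
  have ham : a ≤ max a b := le_max_left a b
  have hbm : b ≤ max a b := le_max_right a b
  exact abs_le.mpr ⟨by linarith, by linarith⟩

theorem sup_pow_gap_nontrivial (ε μ : ℝ) (hε : ε ∈ Set.Ico (0 : ℝ) 1)
    (hμ : μ ∈ Set.Ico (0 : ℝ) 1) (hne : ε ≠ μ) :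
    0 < |ε - μ| ∧
    |ε - μ| ≤ sSup {x : ℝ | ∃ n : ℕ, 1 ≤ n ∧ x = |ε ^ n - μ ^ n|} ∧
    sSup {x : ℝ | ∃ n : ℕ, 1 ≤ n ∧ x = |ε ^ n - μ ^ n|} ≤ max ε μ ∧
    max ε μ < 1 := by
  have hub : ∀ x ∈ {x : ℝ | ∃ n : ℕ, 1 ≤ n ∧ x = |ε ^ n - μ ^ n|}, x ≤ max ε μ := by
    rintro x ⟨n, hn, rfl⟩
    exact abs_pow_sub_pow_le_max hε hμ hn
  have hmem : |ε - μ| ∈ {x : ℝ | ∃ n : ℕ, 1 ≤ n ∧ x = |ε ^ n - μ ^ n|} :=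
    ⟨1, le_rfl, by simp only [pow_one]⟩
  exact ⟨abs_pos.mpr (sub_ne_zero.mpr hne), le_csSup ⟨_, hub⟩ hmem,
    csSup_le ⟨_, hmem⟩ hub, max_lt hε.2 hμ.2⟩
end
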